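/- For all x, y ∈ 𝔸₁, the widening x ∇ y is an upper bound of x and y for the perturbation order, and its concretization γ(x ∇ y) equals the smallest closed interval containing γ(x) ∪ γ(y); moreover, if γ(x) and γ(y) are in generic positions, x ∇ y is a minimal upper bound of x and y. -/

import Mathlib

open scoped BigOperators

/-- A generalized affine form: an `ℓ¹` family of noise coefficients `α` together with a
perturbation coefficient `β`. -/
structure AffineForm where
  α : ℕ → ℝ
  β : ℝ
  hsum : Summable fun i => |α i|

namespace AffineForm

/-- `ℓ¹` distance between the `α`-parts of two forms. -/
noncomputable def distL (x y : AffineForm) : ℝ := ∑' i, |x.α i - y.α i|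

/-- `ℓ¹` norm of the `α`-part. -/
noncomputable def normA (x : AffineForm) : ℝ := ∑' i, |x.α i|

/-- Total deviation of the noise part (indices `i ≥ 1`). -/
noncomputable def dev (x : AffineForm) : ℝ := ∑' i, |x.α (i + 1)|

/-- The perturbation order: `x ≤ y` iff `‖αˣ - αʸ‖₁ ≤ βʸ - βˣ`. -/
def le (x y : AffineForm) : Prop := distL x y ≤ y.β - x.β

/-- Lower bound of the concretization. -/
noncomputable def lo (x : AffineForm) : ℝ := x.α 0 - dev x - x.β

/-- Upper bound of the concretization. -/
noncomputable def hi (x : AffineForm) : ℝ := x.α 0 + dev x + x.β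

/-- The concretization interval. -/
noncomputable def γ (x : AffineForm) : Set ℝ := Set.Icc (lo x) (hi x)

/-- `z` is a minimal upper bound of `x` and `y` for the perturbation order. -/
def IsMub (x y z : AffineForm) : Prop :=
  x.le z ∧ y.le z ∧ ∀ w, x.le w → y.le w → w.le z → w = z

/-- Point of `[min a b, max a b]` of minimal absolute value. -/
noncomputable def argmin (a b : ℝ) : ℝ :=
  if a * b ≤ 0 then 0 else if |a| ≤ |b| then a else b

lemma abs_argmin_le (a b : ℝ) : |argmin a b| ≤ |a| + |b| := by
  unfold argmin
  split_ifs with h1 h2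
  · simpa using add_nonneg (abs_nonneg a) (abs_nonneg b)
  · linarith [abs_nonneg b]
  · linarith [abs_nonneg a]

/-- The concretizations of `x` and `y` are in generic positions. -/
def GenericPos (x y : AffineForm) : Prop :=
  (γ x ⊆ γ y → lo x = lo y ∨ hi x = hi y) ∧
  (γ y ⊆ γ x → lo y = lo x ∨ hi y = hi x)

/-- The widening `x ∇ y`. -/
noncomputable def widen (x y : AffineForm) : AffineForm where
  α := fun i =>
    if i = 0 then (min (lo x) (lo y) + max (hi x) (hi y)) / 2
    else argmin (x.α i) (y.α i)
  β := max (hi x) (hi y) - (min (lo x) (lo y) + max (hi x) (hi y)) / 2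
        - ∑' i, |argmin (x.α (i + 1)) (y.α (i + 1))|
  hsum := by
    have hc : Summable fun i : ℕ =>
        (if i = 0 then |(min (lo x) (lo y) + max (hi x) (hi y)) / 2| else 0 : ℝ) :=
      summable_of_ne_finset_zero (s := {0}) (by
        intro i hi
        simp only [Finset.mem_singleton] at hi
        simp [hi])
    refine Summable.of_nonneg_of_le (fun i => abs_nonneg _) (fun i => ?_)
      ((x.hsum.add y.hsum).add hc)
    by_cases h0 : i = 0
    · subst h0
      simp only [reduceIte]
      linarith [abs_nonneg (x.α 0), abs_nonneg (y.α 0)]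
    · simp only [if_neg h0, add_zero]
      exact abs_argmin_le _ _

lemma summable_abs_sub (x y : AffineForm) : Summable fun i => |x.α i - y.α i| :=
  (x.hsum.of_abs.sub y.hsum.of_abs).abs

lemma abs_sub_argmin_left (a b : ℝ) : |a - argmin a b| = |a| - |argmin a b| := by
  unfold argmin
  split_ifs with h1 h2
  · simp
  · simp
  · push Not at h1 h2
    rcases pos_and_pos_or_neg_and_neg_of_mul_pos h1 with ⟨ha, hb⟩ | ⟨ha, hb⟩
    · rw [abs_of_pos ha, abs_of_pos hb] at *
      exact abs_of_pos (by linarith)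
    · rw [abs_of_neg ha, abs_of_neg hb] at *
      rw [abs_of_neg (by linarith)]
      ring

lemma argmin_comm (a b : ℝ) : argmin a b = argmin b a := by
  unfold argmin
  rw [mul_comm b a]
  split_ifs with h1 h2 h3 h3
  · rfl
  · rcases abs_eq_abs.mp (le_antisymm h2 h3) with h | h
    · exact h
    · subst h
      exact absurd (by nlinarith [sq_nonneg b]) h1
  · rfl
  · rfl
  · linarith

lemma argmin_mem_uIcc (a b : ℝ) : argmin a b ∈ Set.uIcc a b := by
  unfold argmin
  split_ifs with h1 h2
  · rw [Set.mem_uIcc]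
    rcases mul_nonpos_iff.mp h1 with h | h
    · exact Or.inr h.symm
    · exact Or.inl h
  · exact Set.left_mem_uIcc
  · exact Set.right_mem_uIcc

lemma widen_comm (x y : AffineForm) : widen x y = widen y x := by
  unfold widen
  simp only [argmin_comm (x.α _), min_comm (lo x), max_comm (hi x)]

lemma widen_α_succ (x y : AffineForm) (i : ℕ) :
    (widen x y).α (i + 1) = argmin (x.α (i + 1)) (y.α (i + 1)) := by
  simp [widen]

lemma dev_widen (x y : AffineForm) :
    dev (widen x y) = ∑' i, |argmin (x.α (i + 1)) (y.α (i + 1))| := by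
  simp only [dev, widen_α_succ]

lemma lo_widen (x y : AffineForm) : lo (widen x y) = min (lo x) (lo y) := by
  rw [lo, dev_widen]
  simp only [widen, reduceIte]
  ring

lemma hi_widen (x y : AffineForm) : hi (widen x y) = max (hi x) (hi y) := by
  rw [hi, dev_widen]
  simp only [widen, reduceIte]
  ring

lemma distL_eq_of_abs_sub {x z : AffineForm}
    (h : ∀ i, |x.α (i + 1) - z.α (i + 1)| = |x.α (i + 1)| - |z.α (i + 1)|) :
    distL x z = |x.α 0 - z.α 0| + (dev x - dev z) := by
  have hx : Summable fun i => |x.α (i + 1)| :=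
    (summable_nat_add_iff (f := fun i => |x.α i|) 1).mpr x.hsum
  have hz : Summable fun i => |z.α (i + 1)| :=
    (summable_nat_add_iff (f := fun i => |z.α i|) 1).mpr z.hsum
  have h0 := (summable_abs_sub x z).tsum_eq_zero_add
  have h1 := hx.tsum_sub hz
  simp only [h] at h0
  unfold distL dev
  rw [h0, h1]

lemma distL_widen_left (x y : AffineForm) :
    distL x (widen x y) = |x.α 0 - (widen x y).α 0| + (dev x - dev (widen x y)) :=
  distL_eq_of_abs_sub fun i => by rw [widen_α_succ, abs_sub_argmin_left]

lemma le_widen_left (x y : AffineForm) : x.le (widen x y) := by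
  have hlo := lo_widen x y
  have hhi := hi_widen x y
  have h1 := min_le_left (lo x) (lo y)
  have h2 := le_max_left (hi x) (hi y)
  rw [← hlo] at h1
  rw [← hhi] at h2
  unfold lo at h1
  unfold hi at h2
  rw [le, distL_widen_left]
  rcases abs_cases (x.α 0 - (widen x y).α 0) with h | h <;> linarith

lemma le_widen_right (x y : AffineForm) : y.le (widen x y) :=
  widen_comm y x ▸ le_widen_left y x

/-- An endpoint of the hull attained by `x` makes the perturbation inequality tight. -/
lemma sub_le_distL_widen_left {x y : AffineForm}
    (h : lo x = min (lo x) (lo y) ∨ hi x = max (hi x) (hi y)) :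
    (widen x y).β - x.β ≤ distL x (widen x y) := by
  rw [← lo_widen, ← hi_widen] at h
  unfold lo hi at h
  rw [distL_widen_left]
  rcases h with h | h
  · linarith [neg_abs_le (x.α 0 - (widen x y).α 0)]
  · linarith [le_abs_self (x.α 0 - (widen x y).α 0)]

/-- A form lying between `x` and `z` in the order, when `x ≤ z` is tight, lies
coefficientwise between them. -/
lemma abs_add_abs_le_of_le_of_le {x w z : AffineForm} (h : z.β - x.β ≤ distL x z)
    (hxw : x.le w) (hwz : w.le z) (i : ℕ) :
    |x.α i - w.α i| + |w.α i - z.α i| ≤ |x.α i - z.α i| := by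
  have h1 := summable_abs_sub x w
  have h2 := summable_abs_sub w z
  have h3 := summable_abs_sub x z
  have hs := (h1.add h2).sub h3
  have h0 : ∀ j, 0 ≤ |x.α j - w.α j| + |w.α j - z.α j| - |x.α j - z.α j| := fun j =>
    sub_nonneg.mpr (abs_sub_le _ _ _)
  have ht := hs.le_tsum i fun j _ => h0 j
  rw [(h1.add h2).tsum_sub h3, h1.tsum_add h2] at ht
  unfold le at hxw hwz
  unfold distL at *
  linarith

lemma isMub_of_mem_uIcc {x y z : AffineForm} (hxz : x.le z) (hyz : y.le z)
    (hx : z.β - x.β ≤ distL x z) (hy : z.β - y.β ≤ distL y z)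
    (hz : ∀ i, z.α i ∈ Set.uIcc (x.α i) (y.α i)) : IsMub x y z := by
  refine ⟨hxz, hyz, fun w hxw hyw hwz => ?_⟩
  have hα : w.α = z.α := by
    funext i
    have h1 := abs_add_abs_le_of_le_of_le hx hxw hwz i
    have h2 := abs_add_abs_le_of_le_of_le hy hyw hwz i
    have h3 := abs_sub_le (x.α i) (w.α i) (y.α i)
    rw [abs_sub_comm (w.α i) (y.α i)] at h3
    have h4 : |x.α i - z.α i| + |y.α i - z.α i| = |x.α i - y.α i| := by
      rcases Set.mem_uIcc.mp (hz i) with ⟨ha, hb⟩ | ⟨ha, hb⟩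
      · rw [abs_of_nonpos (by linarith), abs_of_nonneg (by linarith),
          abs_of_nonpos (by linarith)]
        ring
      · rw [abs_of_nonneg (by linarith), abs_of_nonpos (by linarith),
          abs_of_nonneg (by linarith)]
        ring
    have h5 : |w.α i - z.α i| ≤ 0 := by linarith
    exact sub_eq_zero.mp (abs_nonpos_iff.mp h5)
  have hβ : w.β = z.β := by
    have hd : distL x w = distL x z := by simp only [distL, hα]
    have hd' : distL w z = 0 := by simp [distL, hα]
    unfold le at hxw hwz
    linarith
  cases w
  cases z
  simp_all

lemma isMub_widen_of_le {x y : AffineForm} (hlo : lo x ≤ lo y) (hhi : hi x ≤ hi y) :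
    IsMub x y (widen x y) := by
  refine isMub_of_mem_uIcc (le_widen_left x y) (le_widen_right x y)
    (sub_le_distL_widen_left (Or.inl (min_eq_left hlo).symm)) ?_ fun i => ?_
  · rw [widen_comm]
    exact sub_le_distL_widen_left (Or.inr (max_eq_left hhi).symm)
  · cases i with
    | zero =>
      rw [Set.mem_uIcc]
      left
      simp only [widen, reduceIte, min_eq_left hlo, max_eq_right hhi]
      unfold lo hi at *
      constructor <;> linarith
    | succ i =>
      rw [widen_α_succ]
      exact argmin_mem_uIcc _ _

lemma IsMub.symm {x y z : AffineForm} (h : IsMub x y z) : IsMub y x z :=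
  ⟨h.2.1, h.1, fun w hy hx hw => h.2.2 w hx hy hw⟩

lemma GenericPos.le_or_le {x y : AffineForm} (h : GenericPos x y) :
    (lo x ≤ lo y ∧ hi x ≤ hi y) ∨ (lo y ≤ lo x ∧ hi y ≤ hi x) := by
  rcases le_total (lo x) (lo y) with hlo | hlo <;> rcases le_total (hi x) (hi y) with hhi | hhi
  · exact Or.inl ⟨hlo, hhi⟩
  · rcases h.2 (Set.Icc_subset_Icc hlo hhi) with e | e
    · exact Or.inr ⟨e.le, hhi⟩
    · exact Or.inl ⟨hlo, e.ge⟩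
  · rcases h.1 (Set.Icc_subset_Icc hlo hhi) with e | e
    · exact Or.inl ⟨e.le, hhi⟩
    · exact Or.inr ⟨hlo, e.ge⟩
  · exact Or.inr ⟨hlo, hhi⟩

/-- The widening `x ∇ y` is an upper bound of `x` and `y` for the perturbation order,
its concretization is the interval hull of `γ x ∪ γ y`, and in generic positions it is
a minimal upper bound. -/
theorem widen_spec (x y : AffineForm) :
    x.le (widen x y) ∧ y.le (widen x y) ∧
    γ (widen x y) = Set.Icc (min (lo x) (lo y)) (max (hi x) (hi y)) ∧
    (GenericPos x y → IsMub x y (widen x y)) := by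
  refine ⟨le_widen_left x y, le_widen_right x y, ?_, fun h => ?_⟩
  · rw [γ, lo_widen, hi_widen]
  · rcases h.le_or_le with ⟨hlo, hhi⟩ | ⟨hlo, hhi⟩
    · exact isMub_widen_of_le hlo hhi
    · exact widen_comm x y ▸ (isMub_widen_of_le hlo hhi).symm

end AffineForm
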